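/- arXiv:1308.4793 — 6 statements merged into one kernel-verified Lean document; each statement's English description precedes it below -/
import Mathlib

section
/- There exists a Steiner triple system of order 27 on the point set {1,…,27} such that: (i) the blocks entirely contained in {1,…,13} form a subsystem STS(13) on {1,…,13}; and (ii) there is a partition of {1,…,27} into three classes X1, X2, X3 with |X1| = 6, |X2| = 9, |X3| = 12 and with |X1 ∩ {1,…,13}| = 2, |X2 ∩ {1,…,13}| = 5, |X3 ∩ {1,…,13}| = 6, such that every block of the STS(27) intersects exactly two of the three classes. -/
/-- `(V, B)` is a Steiner triple system: every block is a 3-element subset of `V`,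
and every pair of distinct points of `V` lies in exactly one block. -/
def IsSTS (V : Finset ℕ) (B : Finset (Finset ℕ)) : Prop :=
  (∀ b ∈ B, b.card = 3 ∧ b ⊆ V) ∧
  ∀ x ∈ V, ∀ y ∈ V, x ≠ y → ∃! b, b ∈ B ∧ x ∈ b ∧ y ∈ b

theorem isSTS_iff_card (V : Finset ℕ) (B : Finset (Finset ℕ)) :
    IsSTS V B ↔ (∀ b ∈ B, b.card = 3 ∧ b ⊆ V) ∧
      ∀ x ∈ V, ∀ y ∈ V, x < y → ((B.filter (x ∈ ·)).filter (y ∈ ·)).card = 1 := by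
  simp only [IsSTS, Finset.filter_filter, Finset.card_eq_one,
    Finset.eq_singleton_iff_unique_mem, Finset.mem_filter]
  refine and_congr_right fun _ => ⟨fun h x hx y hy hxy => h x hx y hy hxy.ne,
    fun h x hx y hy hxy => ?_⟩
  rcases hxy.lt_or_gt with hlt | hgt
  · exact h x hx y hy hlt
  · simpa only [ExistsUnique, and_comm (a := x ∈ _)] using h y hy x hx hgt

instance (V : Finset ℕ) (B : Finset (Finset ℕ)) : Decidable (IsSTS V B) :=
  decidable_of_iff' _ (isSTS_iff_card V B)

/-- The blocks of a 3-bicolorable Steiner triple system of order 27 whose first 26 blocks form a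
subsystem of order 13. -/
def bicolorableBlocks : Finset (Finset ℕ) where
  val := ([{1, 2, 5}, {1, 3, 6}, {1, 4, 7}, {1, 8, 12}, {1, 9, 11}, {1, 10, 13},
    {2, 3, 4}, {2, 6, 7}, {2, 8, 10}, {2, 9, 13}, {2, 11, 12}, {3, 5, 11},
    {3, 7, 12}, {3, 8, 13}, {3, 9, 10}, {4, 5, 10}, {4, 6, 9}, {4, 8, 11},
    {4, 12, 13}, {5, 6, 8}, {5, 7, 13}, {5, 9, 12}, {6, 10, 12}, {6, 11, 13},
    {7, 8, 9}, {7, 10, 11}, {1, 14, 23}, {1, 15, 26}, {1, 16, 27}, {1, 17, 25},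
    {1, 18, 21}, {1, 19, 20}, {1, 22, 24}, {2, 14, 26}, {2, 15, 27}, {2, 16, 25},
    {2, 17, 24}, {2, 18, 20}, {2, 19, 21}, {2, 22, 23}, {3, 14, 18}, {3, 15, 19},
    {3, 16, 20}, {3, 17, 21}, {3, 22, 25}, {3, 23, 26}, {3, 24, 27}, {4, 14, 16},
    {4, 15, 20}, {4, 17, 18}, {4, 19, 24}, {4, 21, 22}, {4, 23, 27}, {4, 25, 26},
    {5, 14, 19}, {5, 15, 18}, {5, 16, 21}, {5, 17, 20}, {5, 22, 26}, {5, 23, 24},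
    {5, 25, 27}, {6, 14, 20}, {6, 15, 21}, {6, 16, 18}, {6, 17, 19}, {6, 22, 27},
    {6, 23, 25}, {6, 24, 26}, {7, 14, 21}, {7, 15, 17}, {7, 16, 19}, {7, 18, 22},
    {7, 20, 23}, {7, 24, 25}, {7, 26, 27}, {8, 14, 27}, {8, 15, 25}, {8, 16, 24},
    {8, 17, 26}, {8, 18, 19}, {8, 20, 22}, {8, 21, 23}, {9, 14, 25}, {9, 15, 24},
    {9, 16, 26}, {9, 17, 27}, {9, 18, 23}, {9, 19, 22}, {9, 20, 21}, {10, 14, 17},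
    {10, 15, 22}, {10, 16, 23}, {10, 18, 27}, {10, 19, 26}, {10, 20, 25}, {10, 21, 24},
    {11, 14, 22}, {11, 15, 23}, {11, 16, 17}, {11, 18, 26}, {11, 19, 27}, {11, 20, 24},
    {11, 21, 25}, {12, 14, 24}, {12, 15, 16}, {12, 17, 22}, {12, 18, 25}, {12, 19, 23},
    {12, 20, 27}, {12, 21, 26}, {13, 14, 15}, {13, 16, 22}, {13, 17, 23}, {13, 18, 24},
    {13, 19, 25}, {13, 20, 26}, {13, 21, 27}] :
    List (Finset ℕ))
  nodup := by decide +kernel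

theorem stmt_0 :
    ∃ B : Finset (Finset ℕ),
      IsSTS (Finset.Icc 1 27) B ∧
      IsSTS (Finset.Icc 1 13) (B.filter (fun b => b ⊆ Finset.Icc 1 13)) ∧
      ∃ X1 X2 X3 : Finset ℕ,
        Disjoint X1 X2 ∧
        Disjoint X1 X3 ∧
        Disjoint X2 X3 ∧
        X1 ∪ X2 ∪ X3 = Finset.Icc 1 27 ∧
        X1.card = 6 ∧
        X2.card = 9 ∧
        X3.card = 12 ∧
        (X1 ∩ Finset.Icc 1 13).card = 2 ∧
        (X2 ∩ Finset.Icc 1 13).card = 5 ∧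
        (X3 ∩ Finset.Icc 1 13).card = 6 ∧
        ∀ b ∈ B,
          (((if (b ∩ X1).Nonempty then 1 else 0) +
           (if (b ∩ X2).Nonempty then 1 else 0) +
           (if (b ∩ X3).Nonempty then 1 else 0) : ℕ) = 2) := by
  refine ⟨bicolorableBlocks, by decide +kernel, by decide +kernel,
    {1, 2} ∪ Finset.Icc 14 17, Finset.Icc 3 7 ∪ Finset.Icc 18 21,
    Finset.Icc 8 13 ∪ Finset.Icc 22 27, ?_⟩
  decide +kernel
end

section
/- There exists a Steiner triple system of order 27 on the point set {1,…,27} such that: (i) the blocks entirely contained in {1,…,13} form a subsystem STS(13) on {1,…,13}; and (ii) there is a partition of {1,…,27} into three classes X1, X2, X3 with |X1| = 9, |X2| = 6, |X3| = 12 and with |X1 ∩ {1,…,13}| = 2, |X2 ∩ {1,…,13}| = 5, |X3 ∩ {1,…,13}| = 6, such that every block of the STS(27) intersects exactly two of the three classes. -/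
/-- The three-element block with the given coordinates. -/
def blockOf (t : ℕ × ℕ × ℕ) : Finset ℕ := {t.1, t.2.1, t.2.2}

/-- Boolean membership of a point in a triple. -/
def tripleHas (t : ℕ × ℕ × ℕ) (x : ℕ) : Bool :=
  t.1 == x || t.2.1 == x || t.2.2 == x

lemma mem_blockOf {t : ℕ × ℕ × ℕ} {x : ℕ} : x ∈ blockOf t ↔ tripleHas t x = true := by
  simp [blockOf, tripleHas, or_assoc, @eq_comm ℕ x]

/-- The finite set of blocks given by a list of triples. -/
def blocksOf (L : List (ℕ × ℕ × ℕ)) : Finset (Finset ℕ) := (L.map blockOf).toFinset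

lemma mem_blocksOf {L : List (ℕ × ℕ × ℕ)} {b : Finset ℕ} :
    b ∈ blocksOf L ↔ ∃ t ∈ L, blockOf t = b := by
  simp [blocksOf]

/-- A list of increasing triples in `Icc 1 n` covering each pair exactly once gives an `STS(n)`. -/
lemma isSTS_blocksOf {n : ℕ} {L : List (ℕ × ℕ × ℕ)}
    (hL : ∀ t ∈ L, 1 ≤ t.1 ∧ t.1 < t.2.1 ∧ t.2.1 < t.2.2 ∧ t.2.2 ≤ n)
    (hcov : ∀ x < n + 1, ∀ y < x, 1 ≤ y →
      (L.filter fun t => tripleHas t x && tripleHas t y).length = 1) :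
    IsSTS (Finset.Icc 1 n) (blocksOf L) := by
  refine ⟨fun b hb => ?_, fun x hx y hy hxy => ?_⟩
  · obtain ⟨t, ht, rfl⟩ := mem_blocksOf.1 hb
    obtain ⟨h1, h2, h3, h4⟩ := hL t ht
    refine ⟨Finset.card_eq_three.2 ⟨_, _, _, h2.ne, (h2.trans h3).ne, h3.ne, rfl⟩, fun z hz => ?_⟩
    simp only [blockOf, Finset.mem_insert, Finset.mem_singleton] at hz
    rw [Finset.mem_Icc]
    omega
  · rw [Finset.mem_Icc] at hx hy
    wlog h : y < x generalizing x y
    · simpa only [and_comm (a := y ∈ _)] using this y hy x hx hxy.symm (by omega)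
    obtain ⟨t, ht⟩ := List.length_eq_one_iff.1 (hcov x (by omega) y h hy.1)
    have key : ∀ s, (s ∈ L ∧ x ∈ blockOf s ∧ y ∈ blockOf s) ↔ s = t := fun s => by
      rw [mem_blockOf, mem_blockOf, ← List.mem_singleton (a := s), ← ht, List.mem_filter, Bool.and_eq_true]
    obtain ⟨htL, htx, hty⟩ := (key t).2 rfl
    refine ⟨blockOf t, ⟨mem_blocksOf.2 ⟨t, htL, rfl⟩, htx, hty⟩, ?_⟩
    rintro b ⟨hb, hbx, hby⟩
    obtain ⟨s, hs, rfl⟩ := mem_blocksOf.1 hb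
    rw [(key s).1 ⟨hs, hbx, hby⟩]

/-- The blocks of an `STS(n)` inside a set `W` form a subsystem as soon as `W` is closed under
taking the third point of a block. -/
lemma IsSTS.filter_subset {V W : Finset ℕ} {B : Finset (Finset ℕ)} (h : IsSTS V B) (hWV : W ⊆ V)
    (hW : ∀ b ∈ B, ∀ x ∈ b, ∀ y ∈ b, x ∈ W → y ∈ W → x ≠ y → b ⊆ W) :
    IsSTS W (B.filter fun b => b ⊆ W) := by
  refine ⟨fun b hb => ?_, fun x hx y hy hxy => ?_⟩
  · rw [Finset.mem_filter] at hb
    exact ⟨(h.1 b hb.1).1, hb.2⟩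
  · obtain ⟨b, ⟨hb, hbx, hby⟩, huniq⟩ := h.2 x (hWV hx) y (hWV hy) hxy
    refine ⟨b, ⟨Finset.mem_filter.2 ⟨hb, hW b hb x hbx y hby hx hy hxy⟩, hbx, hby⟩, ?_⟩
    rintro c ⟨hc, hcx, hcy⟩
    exact huniq c ⟨(Finset.mem_filter.1 hc).1, hcx, hcy⟩

/-- The triples of a 3-bicolored `STS(27)` with a subsystem on `{1, …, 13}`. -/
def triples27 : List (ℕ × ℕ × ℕ) :=
  [
    (1, 2, 3), (1, 4, 5), (1, 6, 7), (1, 8, 9), (1, 10, 11), (1, 12, 13), (1, 14, 21), (1, 15, 22),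
    (1, 16, 23), (1, 17, 24), (1, 18, 25), (1, 19, 26), (1, 20, 27), (2, 4, 6), (2, 5, 7), (2, 8, 10),
    (2, 9, 13), (2, 11, 12), (2, 14, 22), (2, 15, 21), (2, 16, 24), (2, 17, 23), (2, 18, 26), (2, 19, 27),
    (2, 20, 25), (3, 4, 8), (3, 5, 9), (3, 6, 10), (3, 7, 12), (3, 11, 13), (3, 14, 15), (3, 16, 17),
    (3, 18, 19), (3, 20, 21), (3, 22, 23), (3, 24, 25), (3, 26, 27), (4, 7, 13), (4, 9, 11), (4, 10, 12),
    (4, 14, 16), (4, 15, 17), (4, 18, 20), (4, 19, 21), (4, 22, 24), (4, 23, 27), (4, 25, 26), (5, 6, 11),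
    (5, 8, 12), (5, 10, 13), (5, 14, 17), (5, 15, 16), (5, 18, 21), (5, 19, 20), (5, 22, 25), (5, 23, 26),
    (5, 24, 27), (6, 8, 13), (6, 9, 12), (6, 14, 18), (6, 15, 19), (6, 16, 20), (6, 17, 21), (6, 22, 26),
    (6, 23, 24), (6, 25, 27), (7, 8, 11), (7, 9, 10), (7, 14, 19), (7, 15, 18), (7, 16, 21), (7, 17, 20),
    (7, 22, 27), (7, 23, 25), (7, 24, 26), (8, 14, 20), (8, 15, 23), (8, 16, 25), (8, 17, 27), (8, 18, 24),
    (8, 19, 22), (8, 21, 26), (9, 14, 23), (9, 15, 20), (9, 16, 27), (9, 17, 26), (9, 18, 22), (9, 19, 25),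
    (9, 21, 24), (10, 14, 24), (10, 15, 25), (10, 16, 22), (10, 17, 18), (10, 19, 23), (10, 20, 26), (10, 21, 27),
    (11, 14, 25), (11, 15, 24), (11, 16, 26), (11, 17, 19), (11, 18, 27), (11, 20, 22), (11, 21, 23), (12, 14, 26),
    (12, 15, 27), (12, 16, 19), (12, 17, 22), (12, 18, 23), (12, 20, 24), (12, 21, 25), (13, 14, 27), (13, 15, 26),
    (13, 16, 18), (13, 17, 25), (13, 19, 24), (13, 20, 23), (13, 21, 22)]

lemma isSTS_blocksOf_triples27 : IsSTS (Finset.Icc 1 27) (blocksOf triples27) :=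
  isSTS_blocksOf (by decide +kernel) (by decide +kernel)

lemma triples27_closed :
    ∀ t ∈ triples27, 13 < t.2.1 ∨ t.2.2 ≤ 13 := by
  decide +kernel

lemma triples27_increasing :
    ∀ t ∈ triples27, 1 ≤ t.1 ∧ t.1 < t.2.1 ∧ t.2.1 < t.2.2 := by
  decide +kernel

theorem stmt_1 :
    ∃ B : Finset (Finset ℕ),
      IsSTS (Finset.Icc 1 27) B ∧
      IsSTS (Finset.Icc 1 13) (B.filter (fun b => b ⊆ Finset.Icc 1 13)) ∧
      ∃ X1 X2 X3 : Finset ℕ,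
        Disjoint X1 X2 ∧
        Disjoint X1 X3 ∧
        Disjoint X2 X3 ∧
        X1 ∪ X2 ∪ X3 = Finset.Icc 1 27 ∧
        X1.card = 9 ∧
        X2.card = 6 ∧
        X3.card = 12 ∧
        (X1 ∩ Finset.Icc 1 13).card = 2 ∧
        (X2 ∩ Finset.Icc 1 13).card = 5 ∧
        (X3 ∩ Finset.Icc 1 13).card = 6 ∧
        ∀ b ∈ B,
          (((if (b ∩ X1).Nonempty then 1 else 0) +
           (if (b ∩ X2).Nonempty then 1 else 0) +
           (if (b ∩ X3).Nonempty then 1 else 0) : ℕ) = 2) := by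
  refine ⟨blocksOf triples27, isSTS_blocksOf_triples27,
    isSTS_blocksOf_triples27.filter_subset
      (Finset.Icc_subset_Icc le_rfl (by norm_num)) ?_,
    Finset.Icc 1 2 ∪ Finset.Icc 14 20, Finset.Icc 3 7 ∪ {21},
    Finset.Icc 8 13 ∪ Finset.Icc 22 27, by decide +kernel, by decide +kernel, by decide +kernel,
    by decide +kernel, by decide +kernel, by decide +kernel, by decide +kernel, by decide +kernel,
    by decide +kernel, by decide +kernel, ?_⟩
  · intro b hb x hx y hy hxW hyW hxy z hz
    obtain ⟨t, ht, rfl⟩ := mem_blocksOf.1 hb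
    have h1 := triples27_closed t ht
    have h2 := triples27_increasing t ht
    simp only [blockOf, Finset.mem_insert, Finset.mem_singleton] at hx hy hz
    rw [Finset.mem_Icc] at hxW hyW ⊢
    omega
  · intro b hb
    obtain ⟨t, ht, rfl⟩ := mem_blocksOf.1 hb
    clear hb
    revert t
    decide +kernel
end

section
/- There exists a Steiner triple system of order 43 on the point set {1,…,43} such that: (i) the blocks entirely contained in {1,…,21} form a subsystem STS(21) on {1,…,21}; and (ii) there is a partition of {1,…,43} into three classes X1, X2, X3 with |X1| = 10, |X2| = 16, |X3| = 17 and with |X1 ∩ {1,…,21}| = 4, |X2 ∩ {1,…,21}| = 8, |X3 ∩ {1,…,21}| = 9, such that every block of the STS(43) intersects exactly two of the three classes. -/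
/-- `op` restricts to a Steiner quasigroup operation on the off-diagonal pairs of `V`. -/
def IsSteinerOn (op : ℕ → ℕ → ℕ) (V : Finset ℕ) : Prop :=
  ∀ x ∈ V, ∀ y ∈ V, x ≠ y →
    op x y ∈ V ∧ op x y ≠ x ∧ op x y ≠ y ∧ op y x = op x y ∧ op x (op x y) = y

instance (op : ℕ → ℕ → ℕ) (V : Finset ℕ) : Decidable (IsSteinerOn op V) :=
  inferInstanceAs <| Decidable <| ∀ x ∈ V, ∀ y ∈ V, x ≠ y →
    op x y ∈ V ∧ op x y ≠ x ∧ op x y ≠ y ∧ op y x = op x y ∧ op x (op x y) = y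

/-- The triples `{x, y, op x y}` with `x ≠ y` in `V`. -/
def steinerBlocks (op : ℕ → ℕ → ℕ) (V : Finset ℕ) : Finset (Finset ℕ) :=
  V.offDiag.image fun p => {p.1, p.2, op p.1 p.2}

theorem mem_steinerBlocks {op : ℕ → ℕ → ℕ} {V b : Finset ℕ} :
    b ∈ steinerBlocks op V ↔ ∃ x y, x ∈ V ∧ y ∈ V ∧ x ≠ y ∧ {x, y, op x y} = b := by
  simp [steinerBlocks, and_assoc]

theorem IsSteinerOn.eq_of_mem {op : ℕ → ℕ → ℕ} {V b : Finset ℕ} (h : IsSteinerOn op V)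
    (hb : b ∈ steinerBlocks op V) {x y : ℕ} (hx : x ∈ b) (hy : y ∈ b) (hxy : x ≠ y) :
    b = {x, y, op x y} := by
  obtain ⟨u, v, hu, hv, huv, rfl⟩ := mem_steinerBlocks.1 hb
  obtain ⟨hm, hmu, hmv, hc, ha⟩ := h u hu v hv huv
  obtain ⟨-, -, -, hcu, -⟩ := h u hu _ hm hmu.symm
  obtain ⟨-, -, -, hcv, hav⟩ := h v hv _ hm hmv.symm
  have hva : op v (op u v) = u := hc ▸ (h v hv u hu huv.symm).2.2.2.2
  simp only [Finset.mem_insert, Finset.mem_singleton] at hx hy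
  ext z
  simp only [Finset.mem_insert, Finset.mem_singleton]
  rcases hx with rfl | rfl | rfl <;> rcases hy with rfl | rfl | rfl <;> grind

theorem isSTS_steinerBlocks {op : ℕ → ℕ → ℕ} {V : Finset ℕ} (h : IsSteinerOn op V) :
    IsSTS V (steinerBlocks op V) := by
  refine ⟨fun b hb => ?_, fun x hx y hy hxy => ⟨{x, y, op x y}, ⟨?_, by simp, by simp⟩, ?_⟩⟩
  · obtain ⟨x, y, hx, hy, hxy, rfl⟩ := mem_steinerBlocks.1 hb
    obtain ⟨hm, hmx, hmy, -⟩ := h x hx y hy hxy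
    exact ⟨Finset.card_eq_three.2 ⟨x, y, op x y, hxy, hmx.symm, hmy.symm, rfl⟩, by
      simp [Finset.insert_subset_iff, hx, hy, hm]⟩
  · exact mem_steinerBlocks.2 ⟨x, y, hx, hy, hxy, rfl⟩
  · rintro b ⟨hb, hxb, hyb⟩
    exact h.eq_of_mem hb hxb hyb hxy

theorem steinerBlocks_filter_subset {op : ℕ → ℕ → ℕ} {W V : Finset ℕ}
    (hW : IsSteinerOn op W) (hWV : W ⊆ V) :
    (steinerBlocks op V).filter (fun b => b ⊆ W) = steinerBlocks op W := by
  ext b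
  simp only [Finset.mem_filter, mem_steinerBlocks]
  constructor
  · rintro ⟨⟨x, y, -, -, hxy, rfl⟩, hb⟩
    exact ⟨x, y, hb (by simp), hb (by simp), hxy, rfl⟩
  · rintro ⟨x, y, hx, hy, hxy, rfl⟩
    exact ⟨⟨x, y, hWV hx, hWV hy, hxy, rfl⟩, by
      simp [Finset.insert_subset_iff, hx, hy, (hW x hx y hy hxy).1]⟩

/-- Multiplication table of a Steiner triple system on `{1, …, 43}`: the entry `tripleOp x y`
consists of the decimal digits of weight `100 ^ y` in row `x`. -/
def tripleRows : List ℕ := [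
  0,
  4039384342413637272625242322282935343332313004192017181516131407101108091203022106050000,
  4243404137363938343526272524232232333130292818041721191413161506090811100312012007000500,
  4138433736424039332735262225242334323029283114170415201318211609080512110201101900070600,
  3941423643373840253334232627222430313528322901020316131814151705060910070811120019202100,
  3534333231302928434241403938373624232227262520211819110908070604170316151413001210010200,
  3433353130322829414342384039363723222425272619182120091007080502041617141500131101120300,
  3337323529284231402443413626393825302734222310130911161706052001182119040015140802031200,
  3730342928334332224138362742403931252623243517121613211905061820030201000414150711100900,
  3135372834294130423923254336384026273222332413150714060520182103020400011917161012110800,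
  3036393841403142262324223743272529352833343207141312150617201918010004022116030905081100,
  3640314238393243242227374123252633282935303415161407052021191213000102031804170608091000,
  3832363940433041232522422437262728293431353316081510142119171100131803200102040509060700,
  2931262725242322302832334235433440413938373609071008040302010011121921182005061716151400,
  3227292622252423283031433334413542403837363903101109120204000117192018060508071521161300,
  2529302326272224313228343541423338394336403711091203100100040219211720050607081418131600,
  2728233424222625324029353031334243373639413812110804070001020321200605191710091813141500,
  2824252223352726382930313233344337364142394008030201000710120414051506211609111320191800,
  2226282433232527293139303432354136423740384302060500010403090810071214131120191615211700,
  2325223027343533373836282940313239244226434106010005020812111015141307160921180304172000,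
  2623242535313334393637293828323022434041422705000106031109100708161415121318210217041900,
  2422273332263435363740392829303141382343254200050602081211030916150713171019200114180400,
  1821191714161513081112100301040220060509070042274143403837393633343224352326252931283000,
  1920161517181314121009040111020306052108000725424338394140363735303433242227263228293100,
  2117201816131415110710011202030405190600080943412640423936373831353322233425272829303200,
  1519172013141816041201090203111007080006210523404237413643383934292832262724223530313300,
  2018131415211617100102030407121109000819050638432442363739404129283527253022233132333400,
  1614211319151718010311020804101200090705062041223936374338424028332926312523243034323500,
  1716180908070605141315192120010012111004030231303241434233353427262540393837362423222900,
  1315140807090506181716201921000110121103020430323135343342414326252738403936372224232800,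
  1008151906051209131417181600212004070302110129284032333141343537234336422639382725242200,
  913110605201007151814170016192108040212010328382934323035334224413743273640392622252300,
  1412070521061108161513001718201902030901041039292830313534433342372225364138402326272400,
  706052118082019030400131417161511020110091240373639302928313222272423384342413435262500,
  605081609192120020004151814171303011207101137363831294032302825222339412443423327352600,
  509060720171921000203161513181401100411120836393729383231283023242642224041432533342700,
  1110120403020100212019080709060518171615141335343327262524232241434230323129284039383700,
  807090302040001192120111012050617161814131534333525272622242330323141434228293840393600,
  1203011011000402171908062005090715211413181626313423352227252443394029332832303742364100,
  401101200110203200918210506070819151316171432352733232426222540384134282930314336374200,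
  111020012100304071621050619080913142018151733253024223423262739423828293531323637414300,
  304000210010912060805071115141821131720161927242228252330292636313937343235334243403800,
  200041101030710090506121308151614181917202122232526242829273132403635303733344138433900,
  2030104120811050607140910131716201521191824262322282725322938363031373334353941424000]

/-- For distinct `x, y ∈ {1, …, 43}`, the third point of the block through `x` and `y`. -/
def tripleOp (x y : ℕ) : ℕ :=
  tripleRows.getD x 0 / 100 ^ y % 100

theorem stmt_4 :
    ∃ B : Finset (Finset ℕ),
      IsSTS (Finset.Icc 1 43) B ∧
      IsSTS (Finset.Icc 1 21) (B.filter (fun b => b ⊆ Finset.Icc 1 21)) ∧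
      ∃ X1 X2 X3 : Finset ℕ,
        Disjoint X1 X2 ∧
        Disjoint X1 X3 ∧
        Disjoint X2 X3 ∧
        X1 ∪ X2 ∪ X3 = Finset.Icc 1 43 ∧
        X1.card = 10 ∧
        X2.card = 16 ∧
        X3.card = 17 ∧
        (X1 ∩ Finset.Icc 1 21).card = 4 ∧
        (X2 ∩ Finset.Icc 1 21).card = 8 ∧
        (X3 ∩ Finset.Icc 1 21).card = 9 ∧
        ∀ b ∈ B,
          (((if (b ∩ X1).Nonempty then 1 else 0) +
           (if (b ∩ X2).Nonempty then 1 else 0) +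
           (if (b ∩ X3).Nonempty then 1 else 0) : ℕ) = 2) := by
  have h43 : IsSteinerOn tripleOp (Finset.Icc 1 43) := by decide +kernel
  have h21 : IsSteinerOn tripleOp (Finset.Icc 1 21) := by decide +kernel
  refine ⟨steinerBlocks tripleOp (Finset.Icc 1 43),
    isSTS_steinerBlocks h43, ?_,
    Finset.Icc 1 4 ∪ Finset.Icc 22 27, Finset.Icc 5 12 ∪ Finset.Icc 28 35,
    Finset.Icc 13 21 ∪ Finset.Icc 36 43, by decide +kernel, by decide +kernel,
    by decide +kernel, by decide +kernel, by decide +kernel, by decide +kernel,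
    by decide +kernel, by decide +kernel, by decide +kernel, by decide +kernel, ?_⟩
  · rw [steinerBlocks_filter_subset h21 (Finset.Icc_subset_Icc_right (by norm_num))]
    exact isSTS_steinerBlocks h21
  · intro b hb
    obtain ⟨x, y, hx, hy, hxy, rfl⟩ := mem_steinerBlocks.1 hb
    have key : ∀ x ∈ Finset.Icc 1 43, ∀ y ∈ Finset.Icc 1 43, x ≠ y →
        ((if (({x, y, tripleOp x y} : Finset ℕ) ∩
            (Finset.Icc 1 4 ∪ Finset.Icc 22 27)).Nonempty then 1 else 0) +
          (if (({x, y, tripleOp x y} : Finset ℕ) ∩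
            (Finset.Icc 5 12 ∪ Finset.Icc 28 35)).Nonempty then 1 else 0) +
          (if (({x, y, tripleOp x y} : Finset ℕ) ∩
            (Finset.Icc 13 21 ∪ Finset.Icc 36 43)).Nonempty then 1 else 0) : ℕ) = 2 := by
      decide +kernel
    exact key x hx y hy hxy
end

section
/- There exists a Steiner triple system of order 43 on the point set {1,…,43} such that: (i) the blocks entirely contained in {1,…,21} form a subsystem STS(21) on {1,…,21}; and (ii) there is a partition of {1,…,43} into three classes X1, X2, X3 with |X1| = 10, |X2| = 17, |X3| = 16 and with |X1 ∩ {1,…,21}| = 4, |X2 ∩ {1,…,21}| = 8, |X3 ∩ {1,…,21}| = 9, such that every block of the STS(43) intersects exactly two of the three classes. -/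
/-- The underlying set of a triple. -/
def tripleSet (t : ℕ × ℕ × ℕ) : Finset ℕ := {t.1, t.2.1, t.2.2}

/-- The set of blocks underlying a list of triples. -/
def tripleBlocks (T : List (ℕ × ℕ × ℕ)) : Finset (Finset ℕ) := T.toFinset.image tripleSet

/-- Boolean test for a point lying on a triple. -/
def onTriple (x : ℕ) (t : ℕ × ℕ × ℕ) : Bool :=
  Nat.beq x t.1 || Nat.beq x t.2.1 || Nat.beq x t.2.2

/-- Boolean test that all triples are increasing with entries between `1` and `n`. -/
def triplesIncreasing (n : ℕ) (T : List (ℕ × ℕ × ℕ)) : Bool :=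
  T.all fun t => Nat.ble 1 t.1 && Nat.blt t.1 t.2.1 && Nat.blt t.2.1 t.2.2 && Nat.ble t.2.2 n

/-- Boolean test that any two points `x < y` between `1` and `n` lie on exactly one triple. -/
def triplesCoverOnce (n : ℕ) (T : List (ℕ × ℕ × ℕ)) : Bool :=
  (List.range' 1 n).all fun y => (List.range' 1 (y - 1)).all fun x =>
    Nat.beq ((T.filter (onTriple y)).filter (onTriple x)).length 1

theorem mem_tripleSet {x : ℕ} {t : ℕ × ℕ × ℕ} :
    x ∈ tripleSet t ↔ x = t.1 ∨ x = t.2.1 ∨ x = t.2.2 := by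
  simp [tripleSet]

theorem onTriple_iff {x : ℕ} {t : ℕ × ℕ × ℕ} : onTriple x t = true ↔ x ∈ tripleSet t := by
  simp [onTriple, mem_tripleSet, or_assoc]

theorem mem_tripleBlocks {T : List (ℕ × ℕ × ℕ)} {b : Finset ℕ} :
    b ∈ tripleBlocks T ↔ ∃ t ∈ T, tripleSet t = b := by
  simp only [tripleBlocks, Finset.mem_image, List.mem_toFinset]

theorem triplesIncreasing_iff {n : ℕ} {T : List (ℕ × ℕ × ℕ)} :
    triplesIncreasing n T = true ↔
      ∀ t ∈ T, 1 ≤ t.1 ∧ t.1 < t.2.1 ∧ t.2.1 < t.2.2 ∧ t.2.2 ≤ n := by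
  simp only [triplesIncreasing, List.all_eq_true, Bool.and_eq_true, Nat.ble_eq, Nat.blt_eq,
    and_assoc]

theorem existsUnique_tripleBlock_of_lt {n : ℕ} {T : List (ℕ × ℕ × ℕ)}
    (hT : triplesCoverOnce n T = true) {x y : ℕ} (hx : 1 ≤ x) (hxy : x < y) (hy : y ≤ n) :
    ∃! b, b ∈ tripleBlocks T ∧ x ∈ b ∧ y ∈ b := by
  simp only [triplesCoverOnce, List.all_eq_true, List.mem_range'_1, Nat.beq_eq] at hT
  obtain ⟨t, ht⟩ := List.length_eq_one_iff.mp (hT y (by omega) x (by omega))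
  have key : ∀ s, s ∈ T ∧ y ∈ tripleSet s ∧ x ∈ tripleSet s ↔ s = t := by
    intro s
    rw [← List.mem_singleton, ← ht, List.mem_filter, List.mem_filter, onTriple_iff, onTriple_iff,
      and_assoc]
  obtain ⟨htT, htxy⟩ := (key t).mpr rfl
  refine ⟨tripleSet t, ⟨mem_tripleBlocks.mpr ⟨t, htT, rfl⟩, htxy.symm⟩, ?_⟩
  rintro b ⟨hb, hxb⟩
  obtain ⟨s, hs, rfl⟩ := mem_tripleBlocks.mp hb
  rw [(key s).mp ⟨hs, hxb.symm⟩]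

theorem isSTS_tripleBlocks {n : ℕ} {T : List (ℕ × ℕ × ℕ)}
    (hinc : triplesIncreasing n T = true) (hcov : triplesCoverOnce n T = true) :
    IsSTS (Finset.Icc 1 n) (tripleBlocks T) := by
  rw [triplesIncreasing_iff] at hinc
  refine ⟨fun b hb => ?_, fun x hx y hy hxy => ?_⟩
  · obtain ⟨t, ht, rfl⟩ := mem_tripleBlocks.mp hb
    have := hinc t ht
    refine ⟨Finset.card_eq_three.mpr
      ⟨t.1, t.2.1, t.2.2, by omega, by omega, by omega, rfl⟩, fun x hx => ?_⟩
    rw [mem_tripleSet] at hx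
    rw [Finset.mem_Icc]
    omega
  · rw [Finset.mem_Icc] at hx hy
    rcases hxy.lt_or_gt with h | h
    · exact existsUnique_tripleBlock_of_lt hcov hx.1 h hy.2
    · simpa only [and_comm (a := y ∈ _)] using existsUnique_tripleBlock_of_lt hcov hy.1 h hx.2

theorem filter_tripleBlocks_subset_Icc {n : ℕ} {T : List (ℕ × ℕ × ℕ)}
    (hinc : triplesIncreasing n T = true) (m : ℕ) :
    (tripleBlocks T).filter (fun b => b ⊆ Finset.Icc 1 m) =
      tripleBlocks (T.filter fun t => Nat.ble t.2.2 m) := by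
  rw [triplesIncreasing_iff] at hinc
  have key : ∀ t ∈ T, tripleSet t ⊆ Finset.Icc 1 m ↔ t.2.2 ≤ m := by
    intro t ht
    have := hinc t ht
    refine ⟨fun h => (Finset.mem_Icc.mp (h (mem_tripleSet.mpr (.inr (.inr rfl))))).2,
      fun h x hx => ?_⟩
    rw [mem_tripleSet] at hx
    rw [Finset.mem_Icc]
    omega
  ext b
  simp only [Finset.mem_filter, mem_tripleBlocks, List.mem_filter, Nat.ble_eq]
  constructor
  · rintro ⟨⟨t, ht, rfl⟩, hb⟩
    exact ⟨t, ⟨ht, (key t ht).mp hb⟩, rfl⟩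
  · rintro ⟨t, ⟨ht, hm⟩, rfl⟩
    exact ⟨⟨t, ht, rfl⟩, (key t ht).mpr hm⟩

/-- Boolean test for a triple to contain a point of `[a, b] ∪ [c, d]`. -/
def meetsUnion (a b c d : ℕ) (t : ℕ × ℕ × ℕ) : Bool :=
  let p x := Nat.ble a x && Nat.ble x b || Nat.ble c x && Nat.ble x d
  p t.1 || p t.2.1 || p t.2.2

theorem meetsUnion_iff {a b c d : ℕ} {t : ℕ × ℕ × ℕ} :
    meetsUnion a b c d t = true ↔
      (tripleSet t ∩ (Finset.Icc a b ∪ Finset.Icc c d)).Nonempty := by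
  simp [meetsUnion, Finset.Nonempty, mem_tripleSet, or_and_right, exists_or, or_assoc]

/-- The blocks of a 3-bicolorable STS(43) with an STS(21) on the first 21 points. -/
def bicolorableTriples : List (ℕ × ℕ × ℕ) :=
  [(1, 2, 5), (1, 3, 6), (1, 4, 21), (1, 7, 12), (1, 8, 9), (1, 10, 11), (1, 13, 14),
   (1, 15, 16), (1, 17, 18), (1, 19, 20), (1, 22, 28), (1, 23, 43), (1, 24, 42), (1, 25, 41),
   (1, 26, 40), (1, 27, 39), (1, 29, 36), (1, 30, 35), (1, 31, 34), (1, 32, 33), (1, 37, 38),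
   (2, 3, 7), (2, 4, 20), (2, 6, 12), (2, 8, 10), (2, 9, 11), (2, 13, 15), (2, 14, 16),
   (2, 17, 19), (2, 18, 21), (2, 22, 30), (2, 23, 42), (2, 24, 43), (2, 25, 36), (2, 26, 39),
   (2, 27, 35), (2, 28, 34), (2, 29, 33), (2, 31, 32), (2, 37, 40), (2, 38, 41), (3, 4, 19),
   (3, 5, 10), (3, 8, 11), (3, 9, 12), (3, 13, 16), (3, 14, 21), (3, 15, 18), (3, 17, 20),
   (3, 22, 32), (3, 23, 41), (3, 24, 36), (3, 25, 40), (3, 26, 28), (3, 27, 43), (3, 29, 34),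
   (3, 30, 31), (3, 33, 35), (3, 37, 39), (3, 38, 42), (4, 5, 12), (4, 6, 11), (4, 7, 8),
   (4, 9, 10), (4, 13, 17), (4, 14, 15), (4, 16, 18), (4, 22, 43), (4, 23, 36), (4, 24, 41),
   (4, 25, 39), (4, 26, 34), (4, 27, 33), (4, 28, 35), (4, 29, 31), (4, 30, 32), (4, 37, 42),
   (4, 38, 40), (5, 6, 13), (5, 7, 14), (5, 8, 15), (5, 9, 16), (5, 11, 17), (5, 18, 19),
   (5, 20, 21), (5, 22, 29), (5, 23, 35), (5, 24, 34), (5, 25, 33), (5, 26, 32), (5, 27, 36),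
   (5, 28, 43), (5, 30, 42), (5, 31, 40), (5, 37, 41), (5, 38, 39), (6, 7, 15), (6, 8, 14),
   (6, 9, 17), (6, 10, 16), (6, 18, 20), (6, 19, 21), (6, 22, 31), (6, 23, 34), (6, 24, 35),
   (6, 25, 32), (6, 26, 33), (6, 27, 30), (6, 28, 42), (6, 29, 40), (6, 36, 38), (6, 37, 43),
   (6, 39, 41), (7, 9, 20), (7, 10, 21), (7, 11, 18), (7, 13, 19), (7, 16, 17), (7, 22, 34),
   (7, 23, 33), (7, 24, 32), (7, 25, 35), (7, 26, 36), (7, 27, 29), (7, 28, 41), (7, 30, 37),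
   (7, 31, 42), (7, 38, 43), (7, 39, 40), (8, 12, 19), (8, 13, 18), (8, 16, 20), (8, 17, 21),
   (8, 22, 35), (8, 23, 32), (8, 24, 33), (8, 25, 34), (8, 26, 31), (8, 27, 28), (8, 29, 37),
   (8, 30, 38), (8, 36, 40), (8, 39, 43), (8, 41, 42), (9, 13, 21), (9, 14, 18), (9, 15, 19),
   (9, 22, 36), (9, 23, 31), (9, 24, 30), (9, 25, 29), (9, 26, 35), (9, 27, 34), (9, 28, 37),
   (9, 32, 43), (9, 33, 38), (9, 39, 42), (9, 40, 41), (10, 12, 18), (10, 13, 20), (10, 14, 19),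
   (10, 15, 17), (10, 22, 27), (10, 23, 30), (10, 24, 31), (10, 25, 28), (10, 26, 29), (10, 32, 42),
   (10, 33, 41), (10, 34, 38), (10, 35, 39), (10, 36, 37), (10, 40, 43), (11, 12, 13), (11, 14, 20),
   (11, 15, 21), (11, 16, 19), (11, 22, 33), (11, 23, 29), (11, 24, 28), (11, 25, 31), (11, 26, 30),
   (11, 27, 32), (11, 34, 37), (11, 35, 38), (11, 36, 39), (11, 40, 42), (11, 41, 43), (12, 14, 17),
   (12, 15, 20), (12, 16, 21), (12, 22, 26), (12, 23, 28), (12, 24, 29), (12, 25, 30), (12, 27, 31),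
   (12, 32, 38), (12, 33, 39), (12, 34, 40), (12, 35, 37), (12, 36, 41), (12, 42, 43), (13, 22, 42),
   (13, 23, 40), (13, 24, 39), (13, 25, 43), (13, 26, 41), (13, 27, 38), (13, 28, 33), (13, 29, 35),
   (13, 30, 34), (13, 31, 37), (13, 32, 36), (14, 22, 41), (14, 23, 39), (14, 24, 40), (14, 25, 42),
   (14, 26, 43), (14, 27, 37), (14, 28, 38), (14, 29, 32), (14, 30, 36), (14, 31, 33), (14, 34, 35),
   (15, 22, 40), (15, 23, 38), (15, 24, 37), (15, 25, 27), (15, 26, 42), (15, 28, 39), (15, 29, 43),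
   (15, 30, 41), (15, 31, 36), (15, 32, 35), (15, 33, 34), (16, 22, 39), (16, 23, 37), (16, 24, 38),
   (16, 25, 26), (16, 27, 42), (16, 28, 40), (16, 29, 41), (16, 30, 43), (16, 31, 35), (16, 32, 34),
   (16, 33, 36), (17, 22, 38), (17, 23, 27), (17, 24, 26), (17, 25, 37), (17, 28, 36), (17, 29, 42),
   (17, 30, 33), (17, 31, 43), (17, 32, 40), (17, 34, 39), (17, 35, 41), (18, 22, 37), (18, 23, 26),
   (18, 24, 27), (18, 25, 38), (18, 28, 32), (18, 29, 39), (18, 30, 40), (18, 31, 41), (18, 33, 43),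
   (18, 34, 42), (18, 35, 36), (19, 22, 25), (19, 23, 24), (19, 26, 38), (19, 27, 41), (19, 28, 31),
   (19, 29, 30), (19, 32, 39), (19, 33, 37), (19, 34, 43), (19, 35, 40), (19, 36, 42), (20, 22, 24),
   (20, 23, 25), (20, 26, 37), (20, 27, 40), (20, 28, 30), (20, 29, 38), (20, 31, 39), (20, 32, 41),
   (20, 33, 42), (20, 34, 36), (20, 35, 43), (21, 22, 23), (21, 24, 25), (21, 26, 27), (21, 28, 29),
   (21, 30, 39), (21, 31, 38), (21, 32, 37), (21, 33, 40), (21, 34, 41), (21, 35, 42), (21, 36, 43)]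

theorem triplesIncreasing_bicolorableTriples :
    triplesIncreasing 43 bicolorableTriples = true := by
  decide +kernel

theorem bicolorableTriples_meet_two :
    (bicolorableTriples.all fun t =>
      Nat.beq ((meetsUnion 1 4 22 27 t).toNat + (meetsUnion 5 12 28 36 t).toNat +
        (meetsUnion 13 21 37 43 t).toNat) 2) = true := by
  decide +kernel

theorem stmt_5 :
    ∃ B : Finset (Finset ℕ),
      IsSTS (Finset.Icc 1 43) B ∧
      IsSTS (Finset.Icc 1 21) (B.filter (fun b => b ⊆ Finset.Icc 1 21)) ∧
      ∃ X1 X2 X3 : Finset ℕ,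
        Disjoint X1 X2 ∧
        Disjoint X1 X3 ∧
        Disjoint X2 X3 ∧
        X1 ∪ X2 ∪ X3 = Finset.Icc 1 43 ∧
        X1.card = 10 ∧
        X2.card = 17 ∧
        X3.card = 16 ∧
        (X1 ∩ Finset.Icc 1 21).card = 4 ∧
        (X2 ∩ Finset.Icc 1 21).card = 8 ∧
        (X3 ∩ Finset.Icc 1 21).card = 9 ∧
        ∀ b ∈ B,
          (((if (b ∩ X1).Nonempty then 1 else 0) +
           (if (b ∩ X2).Nonempty then 1 else 0) +
           (if (b ∩ X3).Nonempty then 1 else 0) : ℕ) = 2) := by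
  refine ⟨tripleBlocks bicolorableTriples,
    isSTS_tripleBlocks triplesIncreasing_bicolorableTriples (by decide +kernel), ?_,
    Finset.Icc 1 4 ∪ Finset.Icc 22 27, Finset.Icc 5 12 ∪ Finset.Icc 28 36,
    Finset.Icc 13 21 ∪ Finset.Icc 37 43, by decide, by decide, by decide, by decide, by decide,
    by decide, by decide, by decide, by decide, by decide, fun b hb => ?_⟩
  · rw [filter_tripleBlocks_subset_Icc triplesIncreasing_bicolorableTriples]
    exact isSTS_tripleBlocks (by decide +kernel) (by decide +kernel)
  · obtain ⟨t, ht, rfl⟩ := mem_tripleBlocks.mp hb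
    have h := List.all_eq_true.mp bicolorableTriples_meet_two t ht
    simpa only [Nat.beq_eq, Bool.toNat, Bool.cond_eq_ite, meetsUnion_iff] using h
end

section
/- There exists a Steiner triple system of order 91 on the point set {1,…,91} such that: (i) the blocks entirely contained in {1,…,45} form a subsystem STS(45) on {1,…,45}; and (ii) there is a partition of {1,…,91} into four classes X1, X2, X3, X4 with |X1| = 8, |X2| = 14, |X3| = 25, |X4| = 44 and with |X1 ∩ {1,…,45}| = 4, |X2 ∩ {1,…,45}| = 6, |X3 ∩ {1,…,45}| = 13, |X4 ∩ {1,…,45}| = 22, such that every block of the STS(91) intersects exactly two of the four classes. -/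
/-- The multiplication table of the Steiner quasigroup of the system, one row per point:
the base-100 digit number `y` of row `x` is the third point of the block through `x` and `y`. -/
def thirdPointRows : List ℕ := [
    7946787175477677747370729189848587838280888163656264686669675859606150524849515653575455869034363739383542414344404532333031282926272425041511031714191222180216210506070809102320130000,
    4781777446767580737290847170898685888382797864626563676966685958616052495348555750515654918733353840374236434139440445032928313025242726111214151617181920210122230705061008093432001300,
    7548724980817476707786877371828491857989788360616465666759586869636247465053545152558890575637330438353634424540413944022829303124252627121113011415161718192123220910050607084300322000,
    7478497948727770757176738890858183918086828458596160626364656766686946514752505456538987555740380335364533443241420239372726252431302928011312111516141819172221200608090510070043342300,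
    9091888986878485828380817879767774757273707153526055585661596367626549646647696846485750545136323534333940373845434241442627242530312829130618121121151417162320190102030422000708091000,
    8886859182908983848778798081747576777071727354575051595860616263656468484669494766675356525535343633323837403943454442412524272629283130140517131211211516232019180401020300221007080900,
    8385878689889082918479788180757477767170737251505359556158606462666348476546674969685257565439373236343345354442384140432425262728293031091416181320112112221915170223010003040506100800,
    8488799085788791808182838986707172737475767759585456616052576564696862664967466348475551505344454031394341302928272625244238373635343332171915142212231121201018161304000102030905060700,
    7877757376745556725471705791908789868883818061605958636265646968676679848582474849465152535038313941423043452829262724254440363734353233071620211819122211131417150300042301020810050600,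
    7776747578547155567073577287919088898179858262635861605968696665646780838486484647495053515231414243443729284030252427264536393833323534161819172122202314150811120003130204010609070500,
    8779868591898881788084829083717370727674777550465152485747495355545664586059616667696265636814302937132838394231242526273644434032333435020301040506070809454110001215161718192022232100,
    8689908788918078817983858284727073717577747657535248514746504954565569595860686765626166646342434445404127262414313029283534333239381337030204050608090107362500101117181519202123221600,
    8987918090848186797885888382737271707776757452495747505553465651485467616458636960656859666243404516114426151824303128293435323317391236050403060737274238090025410814101920232221010200,
    7170827283858673878975747677787981808488919048544657475150565249555366625968586164636069656711394127432644242512292831303332353442403738060702080301040510000936451513202223161719211800,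
    7273848371708289888577757476817880799091878647514850544956554652535758636265596068666467696141423344452724132625282943313223343540373639300108020403050600103807091411211216171918202200,
    7372708284718387858874767775798078819190868949475654464851535557505260676166625863596964686532293413282435252726394330452033444137363840100907310204030006054201082322112115141817191200,
    8180737077797271767591908674878382788985848846554753575249485456515065606861666459586362676930283132242925333435363738424345404413223941082606100102000305042709072012231121151416181900,
    8271817672807074779189867573838879847887908555564946525354515047574859686963646562616758606628263024292523311327323334353843414536444042391005070900020403013708062219122011211615171400,
    8075768170777379717488918472868990828578838756485549535457525150464763696764656261606668585929242628252030273132343523363739454238434144330810400009010204030706052118221312111514161700,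
    7083716974827975908662638564666584876867899188737277767880814748494653555651575054525960615827232425261928293033223236341637383945414243443509004007103102080605041721141813121101150300,
    8582698473839188869072776466806265638781686789717078757974764846474954505157525355565861596026252729303231343637333835403941422343454422282400091005060708020304011920151617181213141100,
    7674807879755872606959898788619186906684676882707173494648477783818551535250565557546563626425272830313432363338204037394142234344174521290024350810260901070402031816191405061311121500,
    6984837781737890897687717085888267668668807991727574565055545753525161656362605958644647484924202526273118323534373619384015222141424345002928443339081030060503021607170914130112110400,
    6257565854555269534868516149506459676360656684817470717673917972758890898687838580777882464723192018171615141213111009080706050403020100452122434442414039383637353433323130292827262500,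
    5964605055585154524757496769565366686561626378747975739070717289918681778784768385888046824822212320191817161415101108090607040502030001434544424140393836371213343532333031282926272400,
    5355465452514858506863676562606957616466565976828072797381787477708475719088918786834785498921181923201413121516090811100504070601000302421745414344223637403938333235342928313025242700,
    5453614659506757515247686960556664586256636579808576707571738978877484727791908283864849818820222114231512191618080910110405060700010203414443453836133740421739323334352829303124252600,
    5160484757524950465369616356625868656759666481757371747079778090727687785455828691848589888318172219161120100908151413120302010007060504214323394245444135343332403837362726252431302900,
    6150535249484767576451466668656063556962595873788479778275729176717083547456898881908786858019161121181710200809141512130203000106070405222342384541404434353233433936372627242530312800,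
    5652514850535466694967644746686362595865606183778184728076757071747355915785869089878288797817111822210919082010131216140100030205040706154241373943453323323534443640382524272629283100,
    5051475958694653666554484961676855526063646286767783827172707873888756577581847490917980898510091708222321181911121314150001020304050607404139163738432032333435364544422425262728293000,
    5756525169655368476749664655634854625064616087848280867277747170585991907875858988738176837916050717062122230419182001001514131211100908383940343635424531302928272625244341443702033300,
    4854575551496547684666506263696752645953585677837681857478796061737189708890727587808691848202031506050704172220211800011416121310110809193735362334383043312829262724254042413944453200,
    4947586668595065545752695167645646606148535580877888847762637374868982767083718179859172907501061605072203211723190018201312151409081110364038323533374329283130252427264144420239044500,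
    5267595365686346645150604857474961695658555474869062878385667580897278737170889182817679778406020504030116072317001921181213141508091011372033223432363928293031242526273845434241444000,
    5869505647576651656264596848466160495255545390796385838167827675809186887271707384897478877705010607040302222100172320191110090818161513343837333227352625122414313029284243454140394400,
    6063626853465749676661585947485556545169525072888382646590898191798085757674877173708477788603070111021006050021231722041920080916151412353336303113342726251824424028294439383245414300,
    4659545766675661486365626051494758535550695271648687816882808479907588857389747078727783769109040203010611000522072117231808201019121614323634292731332513241526392845303540374442434100,
    5562686760666463496148535258594647565754505165898886698584908287777873749172807970718381757607140901080500110602160304222119102012131715183231283023253524442627382943414537403334364200,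
    6468636162566948556053655850575949515452474685906667809189878882767977868373817274787584717004130802120005061003012207212309171115141816313432192025292427264441283730433338394536423500,
    6361556067645952625046475665585469575349514875668768788691839088857774798976738471827270808115101409001208010204030705062221181623201917273130262529242845431140134442393432333635373800,
    6558676256616864635560525059545753464951484766858969918483888681789076878277758072797371707412151000090201031107040506170822211914232018263029252824321344271645374341313633343538403900,
    6665646361606259585655545352515048474657496970676891908988858786848372828180797877767175747313120010140809020106051615071718112221192320252827242630313433414544294239403236350304383700,
    6849666564636062615958565554535251504847465767916989888786848385828170807978777675749073727108001215101314040701020603050911161722182119202725232426282942394043304131453734323833353600,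
    6766656463626160595856555453525150484746574968699190898887868584838271818079787776757074737200081312150407090305060102161017191820212223242526272928303241114342143138443935364037333400,
    3801262702373135283341293230363934424345444017111418162212131521192004030607081005092325240072717374817076918677847582798578808388894847496460585966696561676263685250535455515756879000,
    234312836012933322527413037353839434544404215161713141211222018211903070405090610082623002473727470807175767887779084838979858881498246486259615860676869656664635153505652545557918600,
    3303283004292640382439313536373243454434424114191512111622172120131807060102100908052700232574737571708481837778797291768088868949854682476361606858626467695966655352515756508790545500,
    3444040329332837393032253124383540364241434516131819221517111214202105020801060709100027262370907173727583778474769186817982878548478078466558596667636964606861625051555253578988565400,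
    3129362530273428264135334240244345443238393711070615132314121819161701210322042002001005080975747679827871727089818580739187908486838877645456526061585966636562694946476867485355515700,
    2831303233262536273529243438434544403742413907151106121416181913172322042120010300020908100576757772717470787384827987889089819183868580585755546162596368646065674749486966465652505300,
    3530322926282441252734423943454433313640373813051211181708191415231602012204210003200709061077767880847279707173918175897490888682878385595553506265645860616967664648634947685451575600,
    2627293537303231242840394345442542384133343605120717191813161123151420220203002101040610090878777975738180748770887172858486898290917683605652576564666259586368614847466749695054555100,
    2733382624103025340931434544424132374039363506140816151918231712111321292800030420220102050779788077767372897471708390758185565591888487625057516463616665685860598682674669475253484900,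
    3926413325240910404243454432273731293836353418171905071323151611141230200028022221030801040680798182898391737672717088787557745477908786635251566769686162596458608485496546664750534800,
    3032243642403809104345444128253437393527263319181608230515141317121131002029220104210206070381808287798674857588737670905791547872717789655350556968606763626159588384664748645146495200,
    3224333828363727293425100935404226413943454412061314171119082316181500313021200222010507030471707276747773888586788289915655838784758190615154536359656058666769648079624868494647525000,
    3642342431252226434544374039412838273035332904081009050607030102320015111213141623172118192082818390777978758091728971598773707674848688518549464748505257535455566766686364656962606100,
    2538353127344143454422363742394024303328292608040907061003050201003218121411152317162013211983828478857677907980898673588874717287709175528147494657515053554856546467696665626863616000,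
    3728254139434445224042353827262936343124303203090504100806073300010216171112231513191420182184858681888287799175807461707371769078778972538346485047565752495154556568646263676669585900,
    2941274043424538443937282431223635263425323009030410080705060033020123131617111419181221201585838786908882848176757360717870918089747279577748475150545546525649536669656462636768595800,
    2439374240454344413620383326282130322729253110020135040934000607050308141523161918121117221386848588838790808982666379747075727773787191544776815251485355564650496964576061596558686700,
    4137404345443539423826202833323029212431272501103602090400340506030719152318130816141722111287868883918984829067856278777276757971817073554874805754495156505346476865525860616459666900,
    4025434544413942352936302120342427332632312802380301370004090708100611051319181714231516122288878984869185686581837774727180827075739076504679785453524849515547575962606158566367696600,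
    4243454435323334363138402641292021282530242739010203003709040810060517230715191812132211141689889091788069816483878485868272777470797371564975765352574654475051486063615559586266676800,
    4345443438393630313733322921202725232226282442414000030102351004070914080516171106151912131890899169686786878285628881808384797176727570747378774946535450574748526158565951556065636400,
    4535423941382729373230262534313323242820222144430040020336010405091013161908071211061815171491696889876688868363907876827781847385807974757170725549475648465752515859545350606164656200,
    4440393734354232332624273629303128252023212245004341013810020309040806181714120515071319161169916785669089648879868783847677787580827481727071734856554751544953466360585057525961626500,
    2336212032314024302228342725332641352937384300454442390201100903080412191806051307111614151768677066758565717290748077878683738179767884918289885655464947485257506261595154535860646300,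
    2014161719151804031001092302081211130607050043222124272825313032262944333435363839374541424049576947484651525053545556606261586465596366796867918785888986907476758280777273718483788100,
    1418200115161017190409230203110813120706000538212228243127253230293345263536343741394342404457464948514750695254555358616460596663566265806768898390848687917574778581767372708278798800,
    1516031418041722090221011019121308110500060737232026303231292524283543273639334042384134444546475751495254506955584853646365625956666160688481677887859091887677747983757071738689828000,
    1615170921231914020110040318131112080005070629202822252624273431333039353840413637324244454347484649535457555152566159506058696762646563866687688578899190847775768188747170728079838200,
    422100220090318011916141517060705000811121335252423283321322634302741392937383140443645434248504746575156535449696064625259556558616867669063878284788179807071728986737677759185888300,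
    319091001220220041714151816070600051208131141282325212729303536243826373132423344454043393450514853694947585660614652545562636864576659678665849079827880817173708889727776748391858700,
    2210191809020103172304161415050006071113081226313327202430213629402842343741254445433532383951525057545946475561495667486863605866695364829162658988838078797270739087717475778184868500,
    1009022317190401180315211614000507061312110833303120293432282226394140252742444543243837353652535154585759494846476469636768656255605650886180668683877981787372719190707574768582898400,
    904012210082312111306070500141516171819030225293421412033263127423935283244454338402436373053545259655058514748576763556146685660626949858866647273747576778284838791868081799071708900,
    111080422172019131207060005161418150310022327362529262128332438374009414445433934423135303254555350565852605968485162464947666369656761708764858475867774768382907257898180788873719100,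
    1917221303181202081105000607211615140401230934272632403020382835363710444543394224332531412955565452476553625859606950664864466168674951718977639186907675748885825770837879817387847200,
    1702181923031311120800050706150414161021090128243033383626203742224425454331403429353239274156585560465348656164505266495467516947635768875972628889917477758583847371827978807686907000,
    1821141606201507050008111213032317190102041022263237312938363940444534434209282735413024253358595655506061636662515746676549645352684748766990867491758885897879807054818487837177727300,
    720231514211606000512081311181704010209190330333731363542414422454329104034242527263938322859615863625549486765645468476669574651505253896086907177768588877981785672809184827570737400,
    823152116130500060711021912010320181422170424322930344239443845432627091025314136283740333560625964524863614951466547685366675057585469907288757974718789738678815556918283857076807700,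
    2107061108140005161513122023040102031917101840422736333935434544412237380930322425342826293161606268596964565766635065534654474967485152785891797370728382868180887155879089847774757600,
    1206110705001413212003181708190222092304161531353839324144454243342536402410302826273329013762636061645666674657685949656953485250515855737583827780797170858491895474788890877281764700,
    1113071200050816140623032210170901202118151932344138354445404339273128422524372633302904360263646156676260665347656851695850495759525554817973747072778471839088917876858982864880467500,
    608050012071121151619130422231810020914011720373934444543424041312438363326352932250330282764656362606167576856536655515948524746545058777884698176708283728087857573908691897949747100,
    1312000507110615231418220801021909101703201621394244454340372725353433244138293230360428312665666467556368546250595857524751534861466056838069717681737084829190867475798785884972777800,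
    500120813060723202102171104091019221516181436403545432537394128384224322633273031294403340166496558616862596369674754565152506053556457847482837571807273708789797677888586917848814600,
    5130611122108071817190109102203041615142023444543424041242937253632303927263528313433023867686665636455466058524948575056615154535962697685708082817372718986877778848388907475477900]

/-- The third point of the block through `x` and `y`, for distinct `x`, `y` in `{1, …, 91}`. -/
def thirdPoint (x y : ℕ) : ℕ := thirdPointRows.getD (x - 1) 0 / 100 ^ y % 100

/-- The index of the colour class of a point. -/
def color (x : ℕ) : ℕ :=
  if x ≤ 4 then 1 else if x ≤ 10 then 2 else if x ≤ 23 then 3 else if x ≤ 45 then 4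
  else if x ≤ 49 then 1 else if x ≤ 57 then 2 else if x ≤ 69 then 3 else 4

/-- `IsBlock x y z` says that `z` completes `x`, `y` to a block, that the operation `thirdPoint`
behaves on this block as a Steiner quasigroup, that the block meets exactly two colour classes,
and that it is contained in `{1, …, 45}` as soon as `x` and `y` are. -/
def IsBlock (x y z : ℕ) : Prop :=
  1 ≤ z ∧ z ≤ 91 ∧ z ≠ x ∧ z ≠ y ∧ thirdPoint y x = z ∧ thirdPoint x z = y ∧
  (x ≤ 45 → y ≤ 45 → z ≤ 45) ∧
  (color x = color y ∧ color z ≠ color x ∨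
    color x ≠ color y ∧ (color z = color x ∨ color z = color y))

instance (x y z : ℕ) : Decidable (IsBlock x y z) := by
  unfold IsBlock; infer_instance

set_option maxRecDepth 100000 in
theorem forall_lt_isBlock : ∀ x < 91, ∀ y < 91, x ≠ y →
    IsBlock (x + 1) (y + 1) (thirdPoint (x + 1) (y + 1)) := by
  decide +kernel

theorem isBlock_thirdPoint {x y : ℕ} (hx : x ∈ Finset.Icc 1 91) (hy : y ∈ Finset.Icc 1 91)
    (hxy : x ≠ y) : IsBlock x y (thirdPoint x y) := by
  rw [Finset.mem_Icc] at hx hy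
  have h := forall_lt_isBlock (x - 1) (by omega) (y - 1) (by omega) (by omega)
  rwa [Nat.sub_add_cancel hx.1, Nat.sub_add_cancel hy.1] at h

/-- The block through two distinct points. -/
def block (x y : ℕ) : Finset ℕ := {x, y, thirdPoint x y}

theorem mem_block {x y z : ℕ} : z ∈ block x y ↔ z = x ∨ z = y ∨ z = thirdPoint x y := by
  simp [block]

theorem block_eq_of_mem {x y a b : ℕ} (hx : x ∈ Finset.Icc 1 91) (hy : y ∈ Finset.Icc 1 91)
    (hxy : x ≠ y) (ha : a ∈ block x y) (hb : b ∈ block x y) (hab : a ≠ b) :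
    block x y = block a b := by
  obtain ⟨h1, h2, h3, h4, h5, h6, -, -⟩ := isBlock_thirdPoint hx hy hxy
  have hz : thirdPoint x y ∈ Finset.Icc 1 91 := Finset.mem_Icc.2 ⟨h1, h2⟩
  obtain ⟨-, -, -, -, h7, -, -, -⟩ := isBlock_thirdPoint hx hz h3.symm
  obtain ⟨-, -, -, -, -, h8, -, -⟩ := isBlock_thirdPoint hy hx hxy.symm
  rw [h5] at h8
  obtain ⟨-, -, -, -, h9, -, -, -⟩ := isBlock_thirdPoint hy hz h4.symm
  have key : thirdPoint a b ∈ block x y ∧ thirdPoint a b ≠ a ∧ thirdPoint a b ≠ b := by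
    rw [mem_block] at ha hb ⊢
    rcases ha with rfl | rfl | rfl <;> rcases hb with rfl | rfl | rfl <;>
      first
      | exact absurd rfl hab
      | grind
  ext c
  rw [mem_block] at ha hb key ⊢
  rw [mem_block]
  grind

/-- The set of blocks of the system. -/
def blocks : Finset (Finset ℕ) :=
  (Finset.Icc 1 91).offDiag.image fun p => block p.1 p.2

theorem mem_blocks {b : Finset ℕ} : b ∈ blocks ↔
    ∃ x ∈ Finset.Icc 1 91, ∃ y ∈ Finset.Icc 1 91, x ≠ y ∧ block x y = b := by
  simp only [blocks, Finset.mem_image, Finset.mem_offDiag, Prod.exists]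
  constructor
  · rintro ⟨x, y, ⟨hx, hy, hxy⟩, h⟩
    exact ⟨x, hx, y, hy, hxy, h⟩
  · rintro ⟨x, hx, y, hy, hxy, h⟩
    exact ⟨x, y, ⟨hx, hy, hxy⟩, h⟩

theorem isSTS_blocks : IsSTS (Finset.Icc 1 91) blocks := by
  refine ⟨fun b hb => ?_, fun x hx y hy hxy => ⟨block x y, ⟨?_, ?_, ?_⟩, ?_⟩⟩
  · obtain ⟨x, hx, y, hy, hxy, rfl⟩ := mem_blocks.1 hb
    obtain ⟨h1, h2, h3, h4, -⟩ := isBlock_thirdPoint hx hy hxy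
    refine ⟨Finset.card_eq_three.2 ⟨x, y, _, hxy, h3.symm, h4.symm, rfl⟩, fun z hz => ?_⟩
    rcases mem_block.1 hz with rfl | rfl | rfl
    exacts [hx, hy, Finset.mem_Icc.2 ⟨h1, h2⟩]
  · exact mem_blocks.2 ⟨x, hx, y, hy, hxy, rfl⟩
  · exact mem_block.2 (.inl rfl)
  · exact mem_block.2 (.inr (.inl rfl))
  · rintro b ⟨hb, hxb, hyb⟩
    obtain ⟨u, hu, v, hv, huv, rfl⟩ := mem_blocks.1 hb
    exact block_eq_of_mem hu hv huv hxb hyb hxy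

theorem isSTS_filter_blocks :
    IsSTS (Finset.Icc 1 45) (blocks.filter (fun b => b ⊆ Finset.Icc 1 45)) := by
  have hsub : Finset.Icc 1 45 ⊆ Finset.Icc 1 91 := Finset.Icc_subset_Icc_right (by norm_num)
  refine ⟨fun b hb => ?_, fun x hx y hy hxy => ?_⟩
  · rw [Finset.mem_filter] at hb
    exact ⟨(isSTS_blocks.1 b hb.1).1, hb.2⟩
  · obtain ⟨b, ⟨hb, hxb, hyb⟩, huniq⟩ := isSTS_blocks.2 x (hsub hx) y (hsub hy) hxy
    refine ⟨b, ⟨Finset.mem_filter.2 ⟨hb, ?_⟩, hxb, hyb⟩, fun c hc =>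
      huniq c ⟨(Finset.mem_filter.1 hc.1).1, hc.2⟩⟩
    obtain ⟨u, hu, v, hv, huv, rfl⟩ := mem_blocks.1 hb
    rw [block_eq_of_mem hu hv huv hxb hyb hxy]
    obtain ⟨h1, -, -, -, -, -, h2, -⟩ := isBlock_thirdPoint (hsub hx) (hsub hy) hxy
    intro z hz
    rcases mem_block.1 hz with rfl | rfl | rfl
    exacts [hx, hy, Finset.mem_Icc.2
      ⟨h1, h2 (Finset.mem_Icc.1 hx).2 (Finset.mem_Icc.1 hy).2⟩]

/-- The set of points with colour `i`. -/
def colorClass (i : ℕ) : Finset ℕ := (Finset.Icc 1 91).filter fun x => color x = i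

theorem disjoint_colorClass {i j : ℕ} (hij : i ≠ j) :
    Disjoint (colorClass i) (colorClass j) :=
  Finset.disjoint_filter.2 fun _ _ hi hj => hij (hi.symm.trans hj)

theorem block_inter_colorClass_nonempty {x y : ℕ} (hx : x ∈ Finset.Icc 1 91)
    (hy : y ∈ Finset.Icc 1 91) (hxy : x ≠ y) (i : ℕ) :
    (block x y ∩ colorClass i).Nonempty ↔
      color x = i ∨ color y = i ∨ color (thirdPoint x y) = i := by
  have hz : thirdPoint x y ∈ Finset.Icc 1 91 := by
    obtain ⟨h1, h2, -⟩ := isBlock_thirdPoint hx hy hxy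
    exact Finset.mem_Icc.2 ⟨h1, h2⟩
  constructor
  · rintro ⟨z, hz⟩
    obtain ⟨hzb, hzc⟩ := Finset.mem_inter.1 hz
    have hc : color z = i := (Finset.mem_filter.1 hzc).2
    rcases mem_block.1 hzb with rfl | rfl | rfl <;> simp [hc]
  · rintro (h | h | h)
    · exact ⟨x, Finset.mem_inter.2 ⟨mem_block.2 (.inl rfl), Finset.mem_filter.2 ⟨hx, h⟩⟩⟩
    · exact ⟨y, Finset.mem_inter.2 ⟨mem_block.2 (.inr (.inl rfl)), Finset.mem_filter.2 ⟨hy, h⟩⟩⟩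
    · exact ⟨_, Finset.mem_inter.2 ⟨mem_block.2 (.inr (.inr rfl)), Finset.mem_filter.2 ⟨hz, h⟩⟩⟩

theorem color_mem (x : ℕ) : color x = 1 ∨ color x = 2 ∨ color x = 3 ∨ color x = 4 := by
  unfold color; split_ifs <;> simp

theorem stmt_6 :
    ∃ B : Finset (Finset ℕ),
      IsSTS (Finset.Icc 1 91) B ∧
      IsSTS (Finset.Icc 1 45) (B.filter (fun b => b ⊆ Finset.Icc 1 45)) ∧
      ∃ X1 X2 X3 X4 : Finset ℕ,
        Disjoint X1 X2 ∧
        Disjoint X1 X3 ∧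
        Disjoint X1 X4 ∧
        Disjoint X2 X3 ∧
        Disjoint X2 X4 ∧
        Disjoint X3 X4 ∧
        X1 ∪ X2 ∪ X3 ∪ X4 = Finset.Icc 1 91 ∧
        X1.card = 8 ∧
        X2.card = 14 ∧
        X3.card = 25 ∧
        X4.card = 44 ∧
        (X1 ∩ Finset.Icc 1 45).card = 4 ∧
        (X2 ∩ Finset.Icc 1 45).card = 6 ∧
        (X3 ∩ Finset.Icc 1 45).card = 13 ∧
        (X4 ∩ Finset.Icc 1 45).card = 22 ∧
        ∀ b ∈ B,
          (((if (b ∩ X1).Nonempty then 1 else 0) +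
           (if (b ∩ X2).Nonempty then 1 else 0) +
           (if (b ∩ X3).Nonempty then 1 else 0) +
           (if (b ∩ X4).Nonempty then 1 else 0) : ℕ) = 2) := by
  refine ⟨blocks, isSTS_blocks, isSTS_filter_blocks,
    colorClass 1, colorClass 2, colorClass 3, colorClass 4,
    disjoint_colorClass (by norm_num), disjoint_colorClass (by norm_num),
    disjoint_colorClass (by norm_num), disjoint_colorClass (by norm_num),
    disjoint_colorClass (by norm_num), disjoint_colorClass (by norm_num),
    by decide +kernel, by decide +kernel, by decide +kernel, by decide +kernel,
    by decide +kernel, by decide +kernel, by decide +kernel, by decide +kernel,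
    by decide +kernel, fun b hb => ?_⟩
  obtain ⟨x, hx, y, hy, hxy, rfl⟩ := mem_blocks.1 hb
  simp only [block_inter_colorClass_nonempty hx hy hxy]
  obtain ⟨-, -, -, -, -, -, -, h⟩ := isBlock_thirdPoint hx hy hxy
  rcases color_mem x with h1 | h1 | h1 | h1 <;> rcases color_mem y with h2 | h2 | h2 | h2 <;>
    rw [h1, h2] at h ⊢ <;> rcases color_mem (thirdPoint x y) with h3 | h3 | h3 | h3 <;>
    rw [h3] at h ⊢ <;> revert h <;> decide
end

section
/- There exists a Steiner triple system of order 27 admitting a strict 3-bicoloring, that is, a partition of its 27 points into 3 nonempty color classes such that every block intersects exactly two of the classes. -/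
/-- The permutation of `ℕ` that cyclically shifts each triple `3k, 3k + 1, 3k + 2`. -/
def tripleShift (x : ℕ) : ℕ := x / 3 * 3 + (x + 1) % 3

/-- Representatives of the orbits of `tripleShift` on the blocks of a Steiner triple system
of order 27 with point set `{0, …, 26}`. -/
def baseBlocks : List (Finset ℕ) :=
  [{0, 1, 6}, {0, 3, 7}, {0, 4, 9}, {0, 5, 11}, {0, 10, 12}, {0, 13, 14}, {0, 15, 16},
   {0, 17, 18}, {0, 19, 20}, {0, 21, 22}, {0, 23, 24}, {0, 25, 26}, {3, 4, 26}, {3, 6, 14},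
   {3, 8, 12}, {3, 10, 13}, {3, 15, 18}, {3, 16, 21}, {3, 17, 19}, {3, 20, 23}, {3, 22, 24},
   {6, 7, 15}, {6, 9, 16}, {6, 10, 18}, {6, 11, 23}, {6, 12, 24}, {6, 19, 26}, {6, 20, 21},
   {6, 22, 25}, {9, 10, 23}, {9, 13, 18}, {9, 15, 25}, {9, 17, 26}, {9, 19, 24},
   {12, 15, 26}, {12, 16, 22}, {12, 17, 21}, {12, 18, 23}, {12, 19, 25}]

/-- The blocks obtained from `baseBlocks` by iterating `tripleShift`. -/
def sts27Blocks : List (Finset ℕ) :=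
  baseBlocks ++ baseBlocks.map (·.image tripleShift) ++
    baseBlocks.map (·.image (tripleShift ∘ tripleShift))

theorem isSTS_toFinset {V : Finset ℕ} {L : List (Finset ℕ)}
    (hL : ∀ b ∈ L, b.card = 3 ∧ b ⊆ V)
    (hpair : ∀ x ∈ V, ∀ y ∈ V, x ≠ y → (L.filter (fun b => x ∈ b ∧ y ∈ b)).length = 1) :
    IsSTS V L.toFinset := by
  refine ⟨fun b hb => hL b (List.mem_toFinset.1 hb), fun x hx y hy hxy => ?_⟩
  obtain ⟨b, hb⟩ := List.length_eq_one_iff.1 (hpair x hx y hy hxy)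
  have hmem (c : Finset ℕ) : (c ∈ L.toFinset ∧ x ∈ c ∧ y ∈ c) ↔ c = b := by
    rw [← List.mem_singleton, ← hb]
    simp
  exact ⟨b, (hmem b).2 rfl, fun c hc => (hmem c).1 hc⟩

theorem isSTS_sts27Blocks : IsSTS (Finset.range 27) sts27Blocks.toFinset :=
  isSTS_toFinset (by decide +kernel) (by decide +kernel)

theorem stmt_11 :
    ∃ (V : Finset ℕ) (B : Finset (Finset ℕ)),
      V.card = 27 ∧ IsSTS V B ∧
      ∃ X1 X2 X3 : Finset ℕ,
        X1.Nonempty ∧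
        X2.Nonempty ∧
        X3.Nonempty ∧
        Disjoint X1 X2 ∧
        Disjoint X1 X3 ∧
        Disjoint X2 X3 ∧
        X1 ∪ X2 ∪ X3 = V ∧
        ∀ b ∈ B,
          (((if (b ∩ X1).Nonempty then 1 else 0) +
           (if (b ∩ X2).Nonempty then 1 else 0) +
           (if (b ∩ X3).Nonempty then 1 else 0) : ℕ) = 2) := by
  refine ⟨Finset.range 27, sts27Blocks.toFinset, by simp, isSTS_sts27Blocks,
    Finset.range 6, Finset.Ico 6 15, Finset.Ico 15 27, by decide, by decide, by decide,
    by decide, by decide, by decide, by decide, fun b hb => ?_⟩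
  have hcolor : ∀ b ∈ sts27Blocks,
      (((if (b ∩ Finset.range 6).Nonempty then 1 else 0) +
       (if (b ∩ Finset.Ico 6 15).Nonempty then 1 else 0) +
       (if (b ∩ Finset.Ico 15 27).Nonempty then 1 else 0) : ℕ) = 2) := by
    decide +kernel
  exact hcolor b (List.mem_toFinset.1 hb)
end
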